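/- arXiv:1602.00390 — 2 statements merged into one kernel-verified Lean document; each statement's English description precedes it below -/
import Mathlib

section
/- Let n ≥ 2 and let F : ℝⁿ → [0,∞) be a Minkowski norm, i.e. F is C^∞ on ℝⁿ \ {0}, F(cv) = cF(v) for all c ≥ 0 and v ∈ ℝⁿ, and for every v ≠ 0 the symmetric bilinear form g_v := (1/2)·D²(F²)(v) is positive definite. Then F satisfies the triangle inequality F(v+w) ≤ F(v) + F(w) for all v,w ∈ ℝⁿ, and it is strictly convex in the sense that equality F(v+w) = F(v)+F(w) holds only when v = aw or w = av for some a ≥ 0. -/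
/-- The fundamental tensor `g_v(w₁,w₂) := (1/2)·D²(F²)(v)[w₁,w₂]`,
half the second Fréchet derivative of `F²` at `v`. -/
noncomputable def fundamentalTensor {n : ℕ} (F : (Fin n → ℝ) → ℝ)
    (v w₁ w₂ : Fin n → ℝ) : ℝ :=
  (1 / 2) * fderiv ℝ (fderiv ℝ (fun x => F x ^ 2)) v w₁ w₂

/-- The second derivative of `f` along the line `t ↦ x + t • d`. -/
lemma deriv_deriv_comp_line {V : Type*} [NormedAddCommGroup V] [NormedSpace ℝ V]
    {f : V → ℝ} {x d : V} {t : ℝ} (hf : ContDiffAt ℝ 2 f (x + t • d)) :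
    deriv (deriv fun s : ℝ => f (x + s • d)) t = fderiv ℝ (fderiv ℝ f) (x + t • d) d d := by
  have hline (s : ℝ) : HasDerivAt (fun s : ℝ => x + s • d) d s := by
    simpa using ((hasDerivAt_id s).smul_const d).const_add x
  have hderiv : deriv (fun s : ℝ => f (x + s • d)) =ᶠ[nhds t]
      fun s => fderiv ℝ f (x + s • d) d := by
    filter_upwards [(hline t).continuousAt.eventually (hf.eventually (by simp))] with s hs
    exact ((hs.differentiableAt (by simp)).hasFDerivAt.comp_hasDerivAt s (hline s)).deriv
  rw [hderiv.deriv_eq]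
  have hf' : DifferentiableAt ℝ (fderiv ℝ f) (x + t • d) :=
    (hf.fderiv_right (m := 1) (by norm_num)).differentiableAt (by simp)
  exact (((ContinuousLinearMap.apply ℝ ℝ d).hasFDerivAt.comp _ hf'.hasFDerivAt).comp_hasDerivAt t
    (hline t)).deriv

/-- A function whose second derivative is positive definite along a segment satisfies the strict
convexity inequality on this segment. -/
lemma lt_of_fderiv_fderiv_pos_on_segment {V : Type*} [NormedAddCommGroup V] [NormedSpace ℝ V]
    {f : V → ℝ} {x y : V} (hf : ∀ z ∈ segment ℝ x y, ContDiffAt ℝ 2 f z)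
    (hpos : ∀ z ∈ segment ℝ x y, 0 < fderiv ℝ (fderiv ℝ f) z (y - x) (y - x))
    {a b : ℝ} (ha : 0 < a) (hb : 0 < b) (hab : a + b = 1) :
    f (a • x + b • y) < a * f x + b * f y := by
  have hmem {t : ℝ} (ht : t ∈ Set.Icc (0 : ℝ) 1) : x + t • (y - x) ∈ segment ℝ x y := by
    rw [segment_eq_image']
    exact ⟨t, ht, rfl⟩
  have hconv : StrictConvexOn ℝ (Set.Icc (0 : ℝ) 1) fun t : ℝ => f (x + t • (y - x)) := by
    refine strictConvexOn_of_deriv2_pos (convex_Icc 0 1) (fun t ht => ?_) fun t ht => ?_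
    · exact ((hf _ (hmem ht)).continuousAt.comp (f := fun t : ℝ => x + t • (y - x))
        (by fun_prop)).continuousWithinAt
    · have ht' := hmem (interior_subset ht)
      simpa [deriv_deriv_comp_line (hf _ ht')] using hpos _ ht'
  have h := hconv.2 (Set.left_mem_Icc.2 zero_le_one) (Set.right_mem_Icc.2 zero_le_one)
    zero_ne_one ha hb hab
  have hx : x + b • (y - x) = a • x + b • y := by
    rw [← eq_sub_iff_add_eq] at hab
    subst hab
    module
  simpa [hx] using h

/-- A Minkowski norm `F` on `ℝⁿ` (smooth away from `0`, positively `1`-homogeneous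
and strongly convex) satisfies the triangle inequality, and it is strictly convex:
`F(v+w) = F(v)+F(w)` forces `v = a•w` or `w = a•v` for some `a ≥ 0`. -/
theorem minkowskiNorm_triangle_strictConvex {n : ℕ} (hn : 2 ≤ n)
    (F : (Fin n → ℝ) → ℝ) (hFnonneg : ∀ v, 0 ≤ F v)
    (hFsmooth : ContDiffOn ℝ (⊤ : ℕ∞) F {(0 : Fin n → ℝ)}ᶜ)
    (hFhomog : ∀ c : ℝ, 0 ≤ c → ∀ v : Fin n → ℝ, F (c • v) = c * F v)
    (hFposdef : ∀ v : Fin n → ℝ, v ≠ 0 → ∀ w : Fin n → ℝ, w ≠ 0 →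
      0 < fundamentalTensor F v w w) :
    (∀ v w : Fin n → ℝ, F (v + w) ≤ F v + F w) ∧
    (∀ v w : Fin n → ℝ, F (v + w) = F v + F w →
      ∃ a : ℝ, 0 ≤ a ∧ (v = a • w ∨ w = a • v)) := by
  have hzero : F 0 = 0 := by simpa using hFhomog 0 le_rfl 0
  have hsq {x y : Fin n → ℝ} (hxy : x ≠ y) (h0 : (0 : Fin n → ℝ) ∉ segment ℝ x y)
      {a b : ℝ} (ha : 0 < a) (hb : 0 < b) (hab : a + b = 1) :
      F (a • x + b • y) ^ 2 < a * F x ^ 2 + b * F y ^ 2 := by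
    have hne {z : Fin n → ℝ} (hz : z ∈ segment ℝ x y) : z ≠ 0 := fun h => h0 (h ▸ hz)
    refine lt_of_fderiv_fderiv_pos_on_segment (f := fun z => F z ^ 2) (fun z hz => ?_)
      (fun z hz => ?_) ha hb hab
    · exact (contDiffAt_infty.1
        (hFsmooth.contDiffAt (isOpen_compl_singleton.mem_nhds (hne hz))) 2).pow 2
    · have h := hFposdef z (hne hz) (y - x) (sub_ne_zero.2 hxy.symm)
      unfold fundamentalTensor at h
      linarith
  have hpos {v : Fin n → ℝ} (hv : v ≠ 0) : 0 < F v := by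
    refine (hFnonneg v).lt_of_ne' fun hFv => ?_
    have hray {c : ℝ} (hc : 0 ≤ c) : F (c • v) = 0 := by rw [hFhomog c hc, hFv, mul_zero]
    have h := hsq (x := v) (y := (2 : ℝ) • v) (fun h => hv (by
        have h' : (2 : ℝ) • v - v = 0 := sub_eq_zero.2 h.symm
        rwa [two_smul, add_sub_cancel_right] at h'))
      (by
        rintro ⟨a, b, ha, hb, hab, h⟩
        rw [smul_smul, ← add_smul, smul_eq_zero] at h
        rcases h with h | h
        · linarith
        · exact hv h)
      (a := 1 / 2) (b := 1 / 2) (by norm_num) (by norm_num) (by norm_num)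
    rw [smul_smul, ← add_smul, hray (by norm_num), hray (by norm_num), hFv] at h
    norm_num at h
  have hopp {c : ℝ} {w : Fin n → ℝ} (hw : w ≠ 0) (hc : 0 < c) (hc1 : c ≤ 1) :
      F (-(c • w) + w) < F (-(c • w)) + F w := by
    have h1 : -(c • w) + w = (1 - c) • w := by module
    rw [h1, hFhomog _ (by linarith)]
    nlinarith [hpos hw, hFnonneg (-(c • w))]
  have hstrict {v w : Fin n → ℝ} (hv : v ≠ 0) (hw : w ≠ 0)
      (hvw : ∀ a : ℝ, 0 ≤ a → v ≠ a • w) : F (v + w) < F v + F w := by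
    have hFv := hpos hv
    have hFw := hpos hw
    by_cases h0 : (0 : Fin n → ℝ) ∈ segment ℝ ((F v)⁻¹ • v) ((F w)⁻¹ • w)
    · obtain ⟨a, b, ha, hb, hab, h⟩ := h0
      rw [smul_smul, smul_smul] at h
      have ha' : 0 < a := by
        refine ha.lt_of_ne' fun h' => ?_
        have hb1 : b = 1 := by linarith
        simp [h', hb1, hFw.ne', hw] at h
      have hb' : 0 < b := by
        refine hb.lt_of_ne' fun h' => ?_
        have ha1 : a = 1 := by linarith
        simp [h', ha1, hFv.ne', hv] at h
      set p := a * (F v)⁻¹ with hp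
      set q := b * (F w)⁻¹ with hq
      have hp0 : 0 < p := by positivity
      have hq0 : 0 < q := by positivity
      rcases le_total q p with hle | hle
      · have hv' : v = -((q / p) • w) := by
          rw [← smul_right_inj hp0.ne', smul_neg, smul_smul, mul_div_cancel₀ _ hp0.ne']
          exact eq_neg_of_add_eq_zero_left h
        have h2 := hopp hw (div_pos hq0 hp0) ((div_le_one hp0).2 hle)
        rwa [← hv'] at h2
      · have hw' : w = -((p / q) • v) := by
          rw [← smul_right_inj hq0.ne', smul_neg, smul_smul, mul_div_cancel₀ _ hq0.ne']
          exact eq_neg_of_add_eq_zero_right h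
        have h2 := hopp hv (div_pos hp0 hq0) ((div_le_one hq0).2 hle)
        rwa [← hw', add_comm, add_comm (F w)] at h2
    · have hne : (F v)⁻¹ • v ≠ (F w)⁻¹ • w := fun h => by
        refine hvw (F v * (F w)⁻¹) (by positivity) ?_
        rw [mul_smul, ← h, smul_inv_smul₀ hFv.ne']
      have hsum : 0 < F v + F w := by positivity
      have h := hsq hne h0 (a := F v / (F v + F w)) (b := F w / (F v + F w)) (by positivity)
        (by positivity) (by field_simp)
      have h1 : (F v / (F v + F w)) • (F v)⁻¹ • v + (F w / (F v + F w)) • (F w)⁻¹ • w =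
          (F v + F w)⁻¹ • (v + w) := by
        rw [smul_smul, smul_smul, smul_add]
        congr 2 <;> field_simp
      rw [h1, hFhomog _ (by positivity), hFhomog _ (by positivity), hFhomog _ (by positivity),
        inv_mul_cancel₀ hFv.ne', inv_mul_cancel₀ hFw.ne', one_pow, mul_one, mul_one, ← add_div,
        div_self hsum.ne', sq_lt_one_iff₀ (mul_nonneg (by positivity) (hFnonneg _)),
        inv_mul_lt_one₀ hsum] at h
      exact h
  refine ⟨fun v w => ?_, fun v w h => ?_⟩
  · rcases eq_or_ne v 0 with rfl | hv
    · simp [hzero]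
    rcases eq_or_ne w 0 with rfl | hw
    · simp [hzero]
    by_cases hvw : ∀ a : ℝ, 0 ≤ a → v ≠ a • w
    · exact (hstrict hv hw hvw).le
    · push Not at hvw
      obtain ⟨a, ha, rfl⟩ := hvw
      have h1 : a • w + w = (a + 1) • w := by module
      rw [h1, hFhomog _ (by linarith), hFhomog _ ha]
      linarith
  · rcases eq_or_ne v 0 with rfl | hv
    · exact ⟨0, le_rfl, Or.inl (zero_smul ℝ w).symm⟩
    rcases eq_or_ne w 0 with rfl | hw
    · exact ⟨0, le_rfl, Or.inr (zero_smul ℝ v).symm⟩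
    by_contra! hvw
    exact (hstrict hv hw fun a ha => (hvw a ha).1).ne h
end

section
/- Let n ≥ 2 and let F : ℝⁿ → [0,∞) be a Minkowski norm, i.e. F is C^∞ on ℝⁿ \ {0}, F(cv) = cF(v) for all c ≥ 0 and v ∈ ℝⁿ, and for every v ≠ 0 the symmetric bilinear form g_v := (1/2)·D²(F²)(v) is positive definite. If g_v(w,w) ≤ F(w)² for all v, w ∈ ℝⁿ \ {0} (i.e. the uniform smoothness constant equals 1), or if F(w)² ≤ g_v(w,w) for all v, w ∈ ℝⁿ \ {0} (i.e. the uniform convexity constant equals 1), then F comes from an inner product: there exists an inner product ⟨·,·⟩ on ℝⁿ such that F(w)² = ⟨w,w⟩ for all w ∈ ℝⁿ. -/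
/-- A function agreeing near `0` with a quadratic polynomial has the expected second derivative. -/
theorem second_deriv_eq_of_eventuallyEq_quadratic {f f' : ℝ → ℝ} {d a b c : ℝ}
    (hf : ∀ᶠ t in nhds 0, HasDerivAt f (f' t) t) (hf' : HasDerivAt f' d 0)
    (heq : f =ᶠ[nhds 0] fun t => a + b * t + c * t ^ 2) : d = 2 * c := by
  have h1 : f' =ᶠ[nhds 0] fun t => b + 2 * c * t := by
    filter_upwards [hf, heq.eventuallyEq_nhds] with t ht ht'
    have h2 : HasDerivAt (fun t : ℝ => a + b * t + c * t ^ 2) (b + 2 * c * t) t := by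
      have := (((hasDerivAt_id t).const_mul b).const_add a).add
        (((hasDerivAt_id t).pow 2).const_mul c)
      refine (this.congr_deriv ?_)
      simp; ring
    exact ht.unique (h2.congr_of_eventuallyEq ht')
  have h3 : HasDerivAt (fun t : ℝ => b + 2 * c * t) (2 * c) 0 := by
    simpa using ((hasDerivAt_id (0 : ℝ)).const_mul (2 * c)).const_add b
  exact hf'.unique (h3.congr_of_eventuallyEq h1)

/-- A function on the line with second derivative at most `2 * c` satisfies a midpoint bound. -/
theorem add_le_of_second_deriv_le {f f' f'' : ℝ → ℝ} {c : ℝ}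
    (hf : ∀ t, HasDerivAt f (f' t) t) (hf' : ∀ t, HasDerivAt f' (f'' t) t)
    (hle : ∀ t, f'' t ≤ 2 * c) : f 1 + f (-1) ≤ 2 * f 0 + 2 * c := by
  have h1 : ∀ t, HasDerivAt (fun t => f t - c * t ^ 2) (f' t - 2 * c * t) t := fun t =>
    ((hf t).sub (((hasDerivAt_id t).pow 2).const_mul c)).congr_deriv (by simp; ring)
  have h2 : ∀ t, HasDerivAt (fun t => f' t - 2 * c * t) (f'' t - 2 * c) t := fun t =>
    ((hf' t).sub ((hasDerivAt_id t).const_mul (2 * c))).congr_deriv (by simp)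
  have hd : deriv (fun t => f t - c * t ^ 2) = fun t => f' t - 2 * c * t :=
    funext fun t => (h1 t).deriv
  have hanti : Antitone (deriv fun t => f t - c * t ^ 2) := by
    rw [hd]
    refine antitone_of_deriv_nonpos (fun t => (h2 t).differentiableAt) fun t => ?_
    rw [(h2 t).deriv]
    linarith [hle t]
  have hconc := hanti.concaveOn_univ_of_deriv fun t => (h1 t).differentiableAt
  have := hconc.2 (Set.mem_univ 1) (Set.mem_univ (-1)) (by norm_num : (0 : ℝ) ≤ 1 / 2)
    (by norm_num : (0 : ℝ) ≤ 1 / 2) (by norm_num)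
  norm_num at this
  linarith

section

variable {n : ℕ} {F : (Fin n → ℝ) → ℝ}

theorem contDiffAt_sq (hF : ContDiffOn ℝ (⊤ : ℕ∞) F {(0 : Fin n → ℝ)}ᶜ)
    {v : Fin n → ℝ} (hv : v ≠ 0) : ContDiffAt ℝ 2 (fun x => F x ^ 2) v :=
  ((hF.contDiffAt (isOpen_compl_singleton.mem_nhds hv)).of_le
    (WithTop.coe_le_coe.2 (le_top : (2 : ℕ∞) ≤ ⊤))).pow 2

theorem hasDerivAt_line (v w : Fin n → ℝ) (t : ℝ) :
    HasDerivAt (fun t : ℝ => v + t • w) w t := by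
  simpa using ((hasDerivAt_id t).smul_const w).const_add v

theorem hasDerivAt_sq_line (hF : ContDiffOn ℝ (⊤ : ℕ∞) F {(0 : Fin n → ℝ)}ᶜ)
    {v w : Fin n → ℝ} {t : ℝ} (h : v + t • w ≠ 0) :
    HasDerivAt (fun t : ℝ => F (v + t • w) ^ 2)
      (fderiv ℝ (fun x => F x ^ 2) (v + t • w) w) t :=
  HasFDerivAt.comp_hasDerivAt (l := fun x => F x ^ 2) t
    ((contDiffAt_sq hF h).differentiableAt (by simp)).hasFDerivAt (hasDerivAt_line v w t)

theorem hasDerivAt_fderiv_sq_line (hF : ContDiffOn ℝ (⊤ : ℕ∞) F {(0 : Fin n → ℝ)}ᶜ)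
    {v w : Fin n → ℝ} {t : ℝ} (h : v + t • w ≠ 0) :
    HasDerivAt (fun t : ℝ => fderiv ℝ (fun x => F x ^ 2) (v + t • w) w)
      (2 * fundamentalTensor F (v + t • w) w w) t := by
  have h1 : ContDiffAt ℝ 1 (fderiv ℝ (fun x => F x ^ 2)) (v + t • w) :=
    (contDiffAt_sq hF h).fderiv_right (by norm_num)
  have h2 := ((h1.differentiableAt (by simp)).hasFDerivAt).comp_hasDerivAt t
    (hasDerivAt_line v w t)
  refine (h2.clm_apply (hasDerivAt_const t w)).congr_deriv ?_
  simp [fundamentalTensor]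

theorem eventually_line_ne_zero {v : Fin n → ℝ} (hv : v ≠ 0) (w : Fin n → ℝ) :
    ∀ᶠ t : ℝ in nhds 0, v + t • w ≠ 0 :=
  (hasDerivAt_line v w 0).continuousAt.eventually_ne (by simpa using hv)

/-- Euler's identity for the fundamental tensor. -/
theorem fundamentalTensor_self (hF : ContDiffOn ℝ (⊤ : ℕ∞) F {(0 : Fin n → ℝ)}ᶜ)
    (hhom : ∀ c : ℝ, 0 ≤ c → ∀ v : Fin n → ℝ, F (c • v) = c * F v)
    {v : Fin n → ℝ} (hv : v ≠ 0) : fundamentalTensor F v v v = F v ^ 2 := by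
  have h := second_deriv_eq_of_eventuallyEq_quadratic
    (a := F v ^ 2) (b := 2 * F v ^ 2) (c := F v ^ 2)
    ((eventually_line_ne_zero hv v).mono fun t ht => hasDerivAt_sq_line hF ht)
    (hasDerivAt_fderiv_sq_line hF (t := 0) (w := v) (by simpa using hv)) ?_
  · simp at h
    linarith
  · filter_upwards [lt_mem_nhds (show (-1 : ℝ) < 0 by norm_num)] with t ht
    rw [show v + t • v = (1 + t) • v by rw [add_smul, one_smul], hhom _ (by linarith)]
    ring

theorem fundamentalTensor_eq_of_parallelogram
    (hF : ContDiffOn ℝ (⊤ : ℕ∞) F {(0 : Fin n → ℝ)}ᶜ)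
    (heq : ∀ c : ℝ, ∀ w, F (c • w) ^ 2 = c ^ 2 * F w ^ 2)
    (hpar : ∀ v w, F (v + w) ^ 2 + F (v - w) ^ 2 = 2 * F v ^ 2 + 2 * F w ^ 2)
    {v : Fin n → ℝ} (hv : v ≠ 0) (w : Fin n → ℝ) : fundamentalTensor F v w w = F w ^ 2 := by
  have hneg : ∀ t : ℝ, v + t • (-w) = v - t • w := fun t => by rw [smul_neg, sub_eq_add_neg]
  have hv0 : ∀ u : Fin n → ℝ, v + (0 : ℝ) • u ≠ 0 := fun u => by simpa using hv
  have h := second_deriv_eq_of_eventuallyEq_quadratic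
    (a := 2 * F v ^ 2) (b := 0) (c := 2 * F w ^ 2)
    (((eventually_line_ne_zero hv w).and (eventually_line_ne_zero hv (-w))).mono fun t ht =>
      (hasDerivAt_sq_line hF ht.1).add (hasDerivAt_sq_line hF ht.2))
    ((hasDerivAt_fderiv_sq_line hF (hv0 w)).add (hasDerivAt_fderiv_sq_line hF (hv0 (-w)))) ?_
  · simp [fundamentalTensor] at h
    simp [fundamentalTensor]
    linarith
  · refine Filter.Eventually.of_forall fun t => ?_
    simp only [Pi.add_apply, hneg, hpar, heq]
    ring

theorem sq_smul_of_even (hhom : ∀ c : ℝ, 0 ≤ c → ∀ v : Fin n → ℝ, F (c • v) = c * F v)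
    (heven : ∀ w, F (-w) ^ 2 = F w ^ 2) (c : ℝ) (w : Fin n → ℝ) :
    F (c • w) ^ 2 = c ^ 2 * F w ^ 2 := by
  rcases le_total 0 c with hc | hc
  · rw [hhom c hc, mul_pow]
  · rw [← heven, ← neg_smul, hhom _ (neg_nonneg.2 hc)]
    ring

/-- A one-sided comparison between `g_v(w,w)` and `F(w)²` forces the parallelogram law. The sign
`s` selects the direction of the comparison. -/
theorem even_and_parallelogram_of_comparison
    (hF : ContDiffOn ℝ (⊤ : ℕ∞) F {(0 : Fin n → ℝ)}ᶜ)
    (hhom : ∀ c : ℝ, 0 ≤ c → ∀ v : Fin n → ℝ, F (c • v) = c * F v)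
    {s : ℝ} (hs : s ≠ 0)
    (h : ∀ v : Fin n → ℝ, v ≠ 0 → ∀ w : Fin n → ℝ, w ≠ 0 →
      s * fundamentalTensor F v w w ≤ s * F w ^ 2) :
    (∀ w, F (-w) ^ 2 = F w ^ 2) ∧
      ∀ v w, F (v + w) ^ 2 + F (v - w) ^ 2 = 2 * F v ^ 2 + 2 * F w ^ 2 := by
  have hle : ∀ w, s * F w ^ 2 ≤ s * F (-w) ^ 2 := fun w => by
    rcases eq_or_ne w 0 with rfl | hw
    · simp
    · have h1 := h w hw (-w) (neg_ne_zero.2 hw)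
      have h2 : fundamentalTensor F w (-w) (-w) = fundamentalTensor F w w w := by
        simp [fundamentalTensor]
      rwa [h2, fundamentalTensor_self hF hhom hw] at h1
  have heven : ∀ w, F (-w) ^ 2 = F w ^ 2 := fun w =>
    mul_left_cancel₀ hs (le_antisymm (by simpa using hle (-w)) (hle w))
  have hsm := sq_smul_of_even hhom heven
  have hpar : ∀ v w, s * (F (v + w) ^ 2 + F (v - w) ^ 2) ≤
      s * (2 * F v ^ 2 + 2 * F w ^ 2) := fun v w => by
    by_cases hz : ∃ t : ℝ, v + t • w = 0
    · obtain ⟨t, ht⟩ := hz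
      obtain rfl : v = (-t) • w := by rw [neg_smul]; exact eq_neg_of_add_eq_zero_left ht
      rw [show (-t) • w + w = (-t + 1) • w by rw [add_smul, one_smul],
        show (-t) • w - w = (-t - 1) • w by rw [sub_smul, one_smul], hsm, hsm, hsm]
      apply le_of_eq
      ring
    · push Not at hz
      rcases ne_or_eq w 0 with hw | rfl
      · have := add_le_of_second_deriv_le (c := s * F w ^ 2)
          (fun t => (hasDerivAt_sq_line hF (hz t)).const_mul s)
          (fun t => (hasDerivAt_fderiv_sq_line hF (hz t)).const_mul s)
          (fun t => by linarith [h _ (hz t) w hw])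
        simp only [one_smul, neg_smul, zero_smul, add_zero, ← sub_eq_add_neg] at this
        linarith
      · have h0 : F 0 = 0 := by simpa using hhom 0 le_rfl 0
        simp [h0, two_mul]
  refine ⟨heven, fun v w => mul_left_cancel₀ hs (le_antisymm (hpar v w) ?_)⟩
  have h1 := hpar (v + w) (v - w)
  rw [show v + w + (v - w) = (2 : ℝ) • v by module,
    show v + w - (v - w) = (2 : ℝ) • w by module, hsm, hsm] at h1
  linarith

end

/-- A Minkowski norm whose 2-uniform smoothness constant equals `1`, or whose
2-uniform convexity constant equals `1`, comes from an inner product: there is a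
symmetric positive-definite bilinear form `B` with `F(w)² = B(w,w)` for all `w`. -/
theorem minkowskiNorm_riemannian_of_unif_const_one {n : ℕ} (hn : 2 ≤ n)
    (F : (Fin n → ℝ) → ℝ) (hFnonneg : ∀ v, 0 ≤ F v)
    (hFsmooth : ContDiffOn ℝ (⊤ : ℕ∞) F {(0 : Fin n → ℝ)}ᶜ)
    (hFhomog : ∀ c : ℝ, 0 ≤ c → ∀ v : Fin n → ℝ, F (c • v) = c * F v)
    (hFposdef : ∀ v : Fin n → ℝ, v ≠ 0 → ∀ w : Fin n → ℝ, w ≠ 0 →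
      0 < fundamentalTensor F v w w)
    (h : (∀ v : Fin n → ℝ, v ≠ 0 → ∀ w : Fin n → ℝ, w ≠ 0 →
            fundamentalTensor F v w w ≤ F w ^ 2) ∨
         (∀ v : Fin n → ℝ, v ≠ 0 → ∀ w : Fin n → ℝ, w ≠ 0 →
            F w ^ 2 ≤ fundamentalTensor F v w w)) :
    ∃ B : (Fin n → ℝ) →ₗ[ℝ] (Fin n → ℝ) →ₗ[ℝ] ℝ,
      (∀ x y : Fin n → ℝ, B x y = B y x) ∧
      (∀ x : Fin n → ℝ, x ≠ 0 → 0 < B x x) ∧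
      (∀ w : Fin n → ℝ, F w ^ 2 = B w w) := by
  obtain ⟨heven, hpar⟩ : (∀ w, F (-w) ^ 2 = F w ^ 2) ∧
      ∀ v w, F (v + w) ^ 2 + F (v - w) ^ 2 = 2 * F v ^ 2 + 2 * F w ^ 2 := by
    rcases h with h | h
    · exact even_and_parallelogram_of_comparison hFsmooth hFhomog one_ne_zero
        fun v hv w hw => by linarith [h v hv w hw]
    · exact even_and_parallelogram_of_comparison hFsmooth hFhomog (neg_ne_zero.2 one_ne_zero)
        fun v hv w hw => by linarith [h v hv w hw]
  have : Nonempty (Fin n) := ⟨⟨0, by omega⟩⟩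
  obtain ⟨e, he⟩ := exists_ne (0 : Fin n → ℝ)
  have hB : ∀ w, fundamentalTensor F e w w = F w ^ 2 := fundamentalTensor_eq_of_parallelogram
    hFsmooth (sq_smul_of_even hFhomog heven) hpar he
  let B : (Fin n → ℝ) →ₗ[ℝ] (Fin n → ℝ) →ₗ[ℝ] ℝ :=
    LinearMap.mk₂ ℝ (fundamentalTensor F e)
      (fun x y z => by simp [fundamentalTensor, mul_add])
      (fun c x y => by simp [fundamentalTensor, mul_left_comm])
      (fun x y z => by simp [fundamentalTensor, mul_add])
      (fun c x y => by simp [fundamentalTensor, mul_left_comm])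
  refine ⟨B, fun x y => ?_, fun x hx => hFposdef e he x hx, fun w => (hB w).symm⟩
  have hsymm : IsSymmSndFDerivAt ℝ (fun x => F x ^ 2) e :=
    (contDiffAt_sq hFsmooth he).isSymmSndFDerivAt (by simp)
  exact congrArg (1 / 2 * ·) (hsymm x y)
end
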